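/- arXiv:2212.04719 — 3 statements merged into one kernel-verified Lean document; each statement's English description precedes it below -/
import Mathlib

section
/- Let m be a positive integer, n = 3m-1, and d = 3(2^m - 1). Then the power function F(x) = x^d over F_{2^n} is 0-APN; that is, (x+1)^d + x^d + 1 = 0 has no solution x in F_{2^n} \ {0,1}. -/
lemma core_alg {F : Type*} [Field F] [CharP F 2] (k p : F)
    (hp : p^3 = k^4 + k)
    (h : (k^3+k+1+(k+1)*p)^6 = (p+(k+1))^3*k*((k+1)*p+k)*(k^2+k+1)*(k+1)^2*
      (p*((k+1)*p+k)+(k+1)^3*(k^2+k+1))) : k^64 = k := by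
  have h2 : (2:F) = 0 := CharTwo.two_eq_zero
  have hn : k^18 + k^16 + k^15*p + k^15 + k^14*p^2 + k^13*p^2 + k^13*p + k^13 + k^12*p^2 + k^12 + k^11*p^2
      + k^11 + k^10*p + k^8*p^2 + k^8 + k^7*p^2 + k^7*p + k^7 + k^6*p^2 + k^5 + k^4*p + k^4 + k^3*p +
      k^3 + k^2*p^2 + k^2 + k*p^2 + p^2 + 1 = 0 := by
    linear_combination h - (k^12 + k^11*p + k^11 + k^10*p + k^9*p + k^8*p^2 + k^8*p + k^7*p^3 + k^7 + k^5*p^3 + k^5*p^2 +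
      k^5*p + k^4*p^3 + k^4*p^2 + k^4*p + k^3*p^3 + k^3*p + k^3 + k^2 + k*p^3 + k*p^2 + k + p^3 + p) * hp
      - (3*k^16*p + 3*k^16 + 3*k^15*p + 3*k^15 + 7*k^14*p^2 + 15*k^14*p + 7*k^14 + 13*k^13*p^2 +
      23*k^13*p + 10*k^13 + 8*k^12*p^3 + 21*k^12*p^2 + 4*k^12*p - 6*k^12 - k^11*p^4 + 16*k^11*p^3 +
      7*k^11*p^2 - 59*k^11*p - 39*k^11 + 3*k^10*p^4 - k^10*p^3 - 118*k^10*p^2 - 241*k^10*p - 104*k^10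
      + 13*k^9*p^4 - 38*k^9*p^3 - 327*k^9*p^2 - 482*k^9*p - 174*k^9 + k^8*p^5 + 11*k^8*p^4 -
      121*k^8*p^3 - 541*k^8*p^2 - 639*k^8*p - 197*k^8 - k^7*p^6 + 5*k^7*p^5 - 216*k^7*p^3 -
      661*k^7*p^2 - 644*k^7*p - 169*k^7 - 2*k^6*p^6 + 5*k^6*p^5 + 3*k^6*p^4 - 191*k^6*p^3 -
      530*k^6*p^2 - 459*k^6*p - 103*k^6 - 3*k^5*p^6 + 3*k^5*p^5 + 19*k^5*p^4 - 68*k^5*p^3 -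
      241*k^5*p^2 - 200*k^5*p - 36*k^5 + 15*k^4*p^5 + 56*k^4*p^4 + 54*k^4*p^3 - 19*k^4*p^2 - 32*k^4*p
      - k^4 + 4*k^3*p^6 + 35*k^3*p^5 + 101*k^3*p^4 + 135*k^3*p^3 + 89*k^3*p^2 + 32*k^3*p + 8*k^3 +
      5*k^2*p^6 + 35*k^2*p^5 + 95*k^2*p^4 + 129*k^2*p^3 + 95*k^2*p^2 + 38*k^2*p + 7*k^2 + 2*k*p^6 +
      16*k*p^5 + 43*k*p^4 + 58*k*p^3 + 43*k*p^2 + 18*k*p + 3*k + 3*p^5 + 7*p^4 + 10*p^3 + 7*p^2 + 3*p) * h2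
  have hf : (k^27 + k^26 + k^25 + k^21 + k^20 + k^19 + k^18 + k^16 + k^15 + k^14 + k^13 + k^7 + k^6 + k^4 +
      k^3 + k^2 + 1)^2 = 0 := by
    linear_combination (k^36 + k^33*p + k^33 + k^32*p^2 + k^32*p + k^31*p^2 + k^30*p^2 + k^29*p^2 + k^27*p^2 + k^26*p^2
      + k^24*p^2 + k^24*p + k^24 + k^21*p + k^20*p + k^19*p^2 + k^18*p^2 + k^18 + k^17*p + k^16*p^2 +
      k^15*p^2 + k^15*p + k^14*p + k^13*p^2 + k^13*p + k^12*p^2 + k^12*p + k^11*p^2 + k^11*p + k^10*p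
      + k^9 + k^8*p^2 + k^8*p + k^7*p^2 + k^7*p + k^6*p + k^6 + k^5*p^2 + k^4*p^2 + k*p^2 + k*p + p^2
      + 1) * hn
      - (k^46*p + k^46 + k^44*p + k^42*p + k^42 + k^41*p + k^41 + k^38 + k^37*p + k^36*p + k^35*p + k^35
      + k^34*p + k^34 + k^33*p + k^32*p + k^31 + k^30 + k^29*p + k^28 + k^27 + k^26*p + k^25 + k^24 +
      k^21*p + k^21 + k^20 + k^19 + k^18*p + k^17*p + k^16*p + k^16 + k^15 + k^14 + k^13*p + k^13 +
      k^12 + k^9*p + k^8 + k^7 + k^6*p + k^6 + k^5 + k^4*p + k^3*p + k^2 + k + p) * hp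
      - (- k^53 - k^52 + k^51*p + k^50*p^2 + k^50*p + k^49*p^2 + k^49*p + k^49 + 2*k^48*p^2 + 2*k^48*p +
      k^47*p^3 + 3*k^47*p^2 + k^47*p - k^47 + k^46*p^3 + 2*k^46*p^2 + 2*k^46*p - 2*k^46 + k^45*p^4 +
      2*k^45*p^3 + 3*k^45*p^2 + 2*k^45*p - 2*k^45 + k^44*p^4 + 2*k^44*p^3 + 3*k^44*p^2 + k^44*p -
      k^44 + 2*k^43*p^4 + k^43*p^3 + 3*k^43*p^2 + 2*k^43*p - k^43 + k^42*p^4 + k^42*p^3 + 4*k^42*p^2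
      + k^42*p - k^42 + k^41*p^4 + k^41*p^3 + 2*k^41*p^2 + k^41*p - 3*k^41 + 2*k^40*p^4 + 2*k^40*p^3
      + 3*k^40*p^2 + 3*k^40*p - 3*k^40 + 2*k^39*p^4 + 3*k^39*p^3 + 4*k^39*p^2 + 3*k^39*p - 2*k^39 +
      3*k^38*p^4 + k^38*p^3 + 3*k^38*p^2 + 2*k^38*p - k^38 + 2*k^37*p^4 + 2*k^37*p^3 + 5*k^37*p^2 +
      4*k^37*p - k^37 + k^36*p^4 + 2*k^36*p^3 + 5*k^36*p^2 + 4*k^36*p + k^35*p^4 + 2*k^35*p^3 +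
      5*k^35*p^2 + 3*k^35*p - k^35 + k^34*p^4 + 4*k^34*p^3 + 6*k^34*p^2 + 2*k^34*p - 4*k^34 +
      2*k^33*p^4 + 4*k^33*p^3 + 4*k^33*p^2 + 4*k^33*p - 4*k^33 + 3*k^32*p^4 + 3*k^32*p^3 + 5*k^32*p^2
      + 3*k^32*p - 3*k^32 + 3*k^31*p^4 + 3*k^31*p^3 + 7*k^31*p^2 + 3*k^31*p - 2*k^31 + 3*k^30*p^4 +
      2*k^30*p^3 + 6*k^30*p^2 + 3*k^30*p - 3*k^30 + 2*k^29*p^4 + 3*k^29*p^3 + 5*k^29*p^2 + 3*k^29*p -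
      3*k^29 + 2*k^28*p^4 + 4*k^28*p^3 + 5*k^28*p^2 + 5*k^28*p - 3*k^28 + 3*k^27*p^4 + 3*k^27*p^3 +
      6*k^27*p^2 + 4*k^27*p - 4*k^27 + 3*k^26*p^4 + 5*k^26*p^3 + 6*k^26*p^2 + 4*k^26*p - 2*k^26 +
      3*k^25*p^4 + 4*k^25*p^3 + 5*k^25*p^2 + 5*k^25*p - 2*k^25 + 3*k^24*p^4 + 3*k^24*p^3 + 7*k^24*p^2
      + 5*k^24*p - k^24 + 2*k^23*p^4 + 5*k^23*p^3 + 7*k^23*p^2 + 4*k^23*p - 3*k^23 + 2*k^22*p^4 +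
      6*k^22*p^3 + 5*k^22*p^2 + 6*k^22*p - 3*k^22 + 2*k^21*p^4 + 5*k^21*p^3 + 6*k^21*p^2 + 5*k^21*p -
      3*k^21 + 3*k^20*p^4 + 5*k^20*p^3 + 8*k^20*p^2 + 4*k^20*p - 3*k^20 + 4*k^19*p^4 + 5*k^19*p^3 +
      7*k^19*p^2 + 6*k^19*p - 3*k^19 + 3*k^18*p^4 + 5*k^18*p^3 + 7*k^18*p^2 + 4*k^18*p - 2*k^18 +
      2*k^17*p^4 + 4*k^17*p^3 + 6*k^17*p^2 + 5*k^17*p - k^17 + 2*k^16*p^4 + 3*k^16*p^3 + 7*k^16*p^2 +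
      4*k^16*p - k^16 + 3*k^15*p^4 + 5*k^15*p^3 + 6*k^15*p^2 + 4*k^15*p - k^15 + 3*k^14*p^4 +
      5*k^14*p^3 + 5*k^14*p^2 + 4*k^14*p + 3*k^13*p^4 + 3*k^13*p^3 + 5*k^13*p^2 + 5*k^13*p +
      3*k^12*p^4 + 3*k^12*p^3 + 5*k^12*p^2 + 3*k^12*p + k^12 + 2*k^11*p^4 + 3*k^11*p^3 + 5*k^11*p^2 +
      2*k^11*p + k^11 + k^10*p^4 + 2*k^10*p^3 + 3*k^10*p^2 + 4*k^10*p - k^10 + k^9*p^4 + 2*k^9*p^3 +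
      3*k^9*p^2 + 2*k^9*p + 2*k^8*p^4 + 3*k^8*p^3 + 4*k^8*p^2 + 2*k^8*p + 2*k^7*p^4 + 2*k^7*p^3 +
      3*k^7*p^2 + 2*k^7*p - k^7 + k^6*p^4 + 2*k^6*p^2 + k^6*p - k^6 + k^5*p^4 + 2*k^5*p^2 + k^5*p +
      k^4*p^3 + 2*k^4*p^2 + 2*k^4*p - k^4 + k^3*p^3 + k^3*p^2 + k^3*p + k^2*p^4 + k^2*p^2 + k*p^4 +
      k*p^2 + k*p + p^2) * h2
  have hg := pow_eq_zero_iff (two_ne_zero) |>.1 hf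
  linear_combination (k^37 + k^36 + k^34 + k^33 + k^28 + k^24 + k^22 + k^18 + k^12 + k^10 + k^7 + k^4 + k^3 + k) * hg
      - (k^63 + k^62 + k^61 + k^60 + k^59 + k^58 + k^57 + k^56 + 2*k^55 + 2*k^54 + 2*k^53 + 2*k^52 +
      2*k^51 + 2*k^50 + 3*k^49 + 2*k^48 + 2*k^47 + k^46 + k^45 + 2*k^44 + 3*k^43 + 2*k^42 + 2*k^41 +
      3*k^40 + 3*k^39 + 3*k^38 + 4*k^37 + 3*k^36 + 2*k^35 + 2*k^34 + 2*k^33 + 2*k^32 + 3*k^31 +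
      3*k^30 + 2*k^29 + 4*k^28 + 2*k^27 + 3*k^26 + 3*k^25 + 3*k^24 + 2*k^23 + 3*k^22 + 2*k^21 +
      2*k^20 + 2*k^19 + 2*k^18 + 2*k^17 + 2*k^16 + k^15 + 2*k^14 + k^13 + k^12 + k^11 + 2*k^10 + k^9
      + k^8 + 2*k^7 + k^6 + k^5 + k^4 + k^3) * h2 - k * h2


lemma core_field {F : Type*} [Field F] [CharP F 2] (k k1 k2 T T1 T2 : F)
    (hk : k ≠ 0) (hg : k + 1 ≠ 0) (hk1 : k1 ≠ 0)
    (hT : T * k = (k+1)^3) (hT1 : T1 * k1 = (k1+1)^3) (hT2 : T2 * k2 = (k2+1)^3)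
    (c0 : (k1+1)^3 = (k+1)^3 + T + T^2) (c1 : (k2+1)^3 = (k1+1)^3 + T1 + T1^2)
    (e0 : (k+1)^3 = T + T1 + T2) : k^64 = k := by
  have h2 : (2:F) = 0 := CharTwo.two_eq_zero
  obtain ⟨p, hpd⟩ : ∃ p, p * (k+1) = k * (k1+1) := ⟨k*(k1+1)/(k+1), by field_simp⟩
  have hN : (k1+1)^3 * k^2 = (k+1)^4 * (k^2+k+1) := by
    linear_combination k^2 * c0 + (k + T*k + (k+1)^3) * hT
      + (k + 4*k^2 + 6*k^3 + 4*k^4 + k^5) * h2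
  have hp : p^3 = k^4 + k := by
    have : (k+1)^3 * (p^3 - (k^4+k)) = 0 := by
      have e : (p * (k+1))^3 = (k * (k1+1))^3 := by rw [hpd]
      linear_combination e + k * hN + (k+1)^3 * (k^3+k^2) * h2
    have := (mul_eq_zero.1 this).resolve_left (pow_ne_zero _ hg)
    linear_combination this
  apply core_alg k p hp
  obtain ⟨u, hu⟩ : ∃ u, u = (k+1)*p+k := ⟨_, rfl⟩
  have huk : u = k * k1 := by linear_combination hu + hpd + k * h2
  have hu0 : u ≠ 0 := by rw [huk]; exact mul_ne_zero hk hk1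
  have a1 : T1 * u * k = (k+1)^4 * (k^2+k+1) := by
    rw [huk]; linear_combination k^2 * hT1 + hN
  have a2 : T2 * (k * u) = (k+1)^4 * (u + (k^2+k+1)) := by
    linear_combination (-k*u) * e0 - u * hT - a1 
      - (1+5*k+3*k*u+11*k^2+3*k^2*u+14*k^3+k^3*u+11*k^4+5*k^5+k^6+u) * h2
  have a3 : (k2+1)^3 * (k^2*u^2) = (k+1)^5 * (k^2+k+1) * (p*u + (k+1)^3*(k^2+k+1)) := by
    linear_combination k^2*u^2 * c1 + u^2 * hN + (k*u + T1*u*k + (k+1)^4*(k^2+k+1)) * a1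
      + (k+1)^4*(k^2+k+1)*u * hu + (k+1)^4*(k^2+k+1)*u*k * h2
  have a4 : (T2 + (k2+1)^3) * (k^2*u^2) = (k+1)^6 * (k^3+k+1+(k+1)*p)^2 := by
    subst hu
    linear_combination (k*((k+1)*p+k)) * a2 + a3
       + (k+1)^4*(2*k^7 - k^6*p + 7*k^6 - 3*k^5*p + 12*k^5 - 3*k^4*p + 15*k^4 - 2*k^3*p + 13*k^3 - 3*k^2*p + 6*k^2 - 3*k*p + k - p)*h2
  have a5 : (T2 + (k2+1)^3)^3 = T2^3 * (k2+1)^3 := by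
    rw [← hT2]
    have : T2^3 * (T2 * k2) = T2^3 * (k2+1)^3 := by rw [hT2]
    linear_combination -this
  rw [← hu]
  have huc : u + (k^2+k+1) = (k+1)*(p+(k+1)) := by
    linear_combination hu
  apply mul_left_cancel₀ (pow_ne_zero 18 hg)
  calc (k+1)^18 * (k^3+k+1+(k+1)*p)^6 = ((k+1)^6 * (k^3+k+1+(k+1)*p)^2)^3 := by ring
    _ = (T2 + (k2+1)^3)^3 * (k^2*u^2)^3 := by rw [← a4]; ring
    _ = (T2 * (k*u))^3 * ((k2+1)^3 * (k^2*u^2)) * (k*u) := by rw [a5]; ring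
    _ = _ := by rw [a2, a3, huc]; ring

lemma base_rel {F : Type*} [Field F] [CharP F 2] (x y k : F)
    (hx1 : x + 1 ≠ 0) (hxy : x + y ≠ 0) (hy1 : y + 1 ≠ 0)
    (hk : k = x * (y+1) / ((x+y)*(x+1)))
    (h : (y+1)^3*x^3 + y^3*(x+1)^3 + x^3*(x+1)^3 = 0) :
    (k+1)^3 = x/(x+1) + (x/(x+1))^2 ∧ (x/(x+1) + y/(y+1)) * k = (k+1)^3 := by
  have h2 : (2:F) = 0 := CharTwo.two_eq_zero
  have e1 : k + 1 = (x^2+y)/((x+y)*(x+1)) := by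
    rw [hk]; field_simp; linear_combination (x*y+x) * h2
  have e2 : (x^2+y)^3 = x*(x+1)*(x+y)^3 := by
    linear_combination h
      - (2*x^5+3*x^3*y^2+2*x^2*y^3+2*x^4+3*x^3*y+2*x*y^3+x^3*y^3+x^3) * h2
  have e3 : x/(x+1) + (x/(x+1))^2 = x/(x+1)^2 := by
    field_simp; linear_combination x^2 * h2
  have e4 : x/(x+1) + y/(y+1) = (x+y)/((x+1)*(y+1)) := by
    field_simp; linear_combination (x*y) * h2
  have e5 : (k+1)^3 = x/(x+1)^2 := by
    rw [e1, div_pow, e2]; field_simp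
  refine ⟨by rw [e5, e3], ?_⟩
  rw [e5, e4, hk]; field_simp

lemma gcd_step {F : Type*} [Field F] [CharP F 2] (m : ℕ) (hm : 0 < m) (k : F)
    (h1 : k^64 = k) (h2 : k^(2^(3*m-1)) = k) : k^4 = k := by
  have a1 : Function.IsPeriodicPt (frobenius F 2) 6 k := by
    rw [Function.IsPeriodicPt, Function.IsFixedPt, iterate_frobenius]
    simpa using h1
  have a2 : Function.IsPeriodicPt (frobenius F 2) (3*m-1) k := by
    rw [Function.IsPeriodicPt, Function.IsFixedPt, iterate_frobenius]
    exact h2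
  have a3 := a1.gcd a2
  have a4 : Nat.gcd 6 (3*m-1) ∣ 2 := by
    have b1 : Nat.Coprime 3 (3*m-1) := by
      rw [Nat.Prime.coprime_iff_not_dvd Nat.prime_three]; omega
    have : Nat.Coprime (Nat.gcd 6 (3*m-1)) 3 :=
      (b1.coprime_dvd_right (Nat.gcd_dvd_right _ _)).symm
    exact this.dvd_of_dvd_mul_right (Nat.gcd_dvd_left 6 _)
  have a5 := a3.trans_dvd a4
  rw [Function.IsPeriodicPt, Function.IsFixedPt, iterate_frobenius] at a5
  simpa using a5

theorem zero_apn_3 (m : ℕ) (hm : 0 < m) 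
    (x : GaloisField 2 (3*m-1)) (hx0 : x ≠ 0) (hx1 : x ≠ 1) :
    (x + 1) ^ (3*(2^m-1)) + x ^ (3*(2^m-1)) + 1 ≠ 0 := by
  intro heq
  have hn : 3*m-1 ≠ 0 := by omega
  have h2 : (2 : GaloisField 2 (3*m-1)) = 0 := CharTwo.two_eq_zero
  have hcard : ∀ z : GaloisField 2 (3*m-1), z^(2^(3*m-1)) = z := by
    intro z
    have := Fintype.ofFinite (GaloisField 2 (3*m-1))
    have := FiniteField.pow_card z
    rwa [← Nat.card_eq_fintype_card, GaloisField.card 2 _ hn] at this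
  obtain ⟨σ, hσ⟩ : ∃ σ : GaloisField 2 (3*m-1) →+* GaloisField 2 (3*m-1),
      ∀ z, σ z = z^(2^m) := ⟨iterateFrobenius _ 2 m, fun z => iterateFrobenius_def 2 m z⟩
  have hσ3 : ∀ z, σ (σ (σ z)) = z^2 := by
    intro z
    rw [hσ, hσ, hσ, ← pow_mul, ← pow_mul, ← pow_add, ← pow_add]
    have : m + (m + m) = (3*m-1) + 1 := by omega
    rw [this, pow_succ, pow_mul, hcard]
  have hx1' : x + 1 ≠ 0 := fun h => hx1 (by linear_combination h - h2)
  have hpos : 2^m - 1 + 1 = 2^m := Nat.sub_add_cancel Nat.one_le_two_pow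
  obtain ⟨u, hu⟩ : ∃ u, u = x^(2^m-1) := ⟨_, rfl⟩
  obtain ⟨v, hv⟩ : ∃ v, v = (x+1)^(2^m-1) := ⟨_, rfl⟩
  have hux : u * x = σ x := by rw [hu, hσ, ← pow_succ, hpos]
  have hvx : v * (x+1) = σ x + 1 := by
    rw [hv, ← pow_succ, hpos, ← hσ, map_add, map_one]
  rw [mul_comm 3 (2^m-1), pow_mul, pow_mul, ← hu, ← hv] at heq
  have hxy : x + σ x ≠ 0 := by
    intro h
    have u1 : u = 1 := mul_right_cancel₀ hx0 (by linear_combination hux + h - x * h2)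
    have v1 : v = 1 := mul_right_cancel₀ hx1' (by linear_combination hvx + h - x * h2)
    rw [u1, v1] at heq
    exact one_ne_zero (α := GaloisField 2 (3*m-1)) (by linear_combination heq - h2)
  have hy1 : σ x + 1 ≠ 0 := by
    rw [← map_one σ, ← map_add]; exact (map_ne_zero σ).2 hx1'
  have hP : (σ x+1)^3*x^3 + (σ x)^3*(x+1)^3 + x^3*(x+1)^3 = 0 := by
    rw [← hvx, ← hux]; linear_combination x^3*(x+1)^3 * heq
  obtain ⟨k, hk⟩ : ∃ k, k = x * (σ x+1) / ((x+σ x)*(x+1)) := ⟨_, rfl⟩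
  obtain ⟨r, hr⟩ : ∃ r, r = x/(x+1) := ⟨_, rfl⟩
  have hr1 : σ x / (σ x + 1) = σ r := by rw [hr]; simp
  obtain ⟨A, B⟩ := base_rel x (σ x) k hx1' hxy hy1 hk hP
  rw [hr1, ← hr] at B
  rw [← hr] at A
  have hr0 : r ≠ 0 := by rw [hr]; exact div_ne_zero hx0 hx1'
  have hk0 : k ≠ 0 := by
    rw [hk]; exact div_ne_zero (mul_ne_zero hx0 hy1) (mul_ne_zero hxy hx1')
  have hrr : r + r^2 = x/(x+1)^2 := by
    rw [hr]; field_simp; linear_combination x * h2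
  have hg0 : k + 1 ≠ 0 := by
    intro h
    rw [h, hrr] at A
    have := div_ne_zero hx0 (pow_ne_zero 2 hx1')
    exact this (by rw [← A]; ring)
  have A1 : (σ k + 1)^3 = σ r + (σ r)^2 := by simpa using congrArg σ A
  have A2 : (σ (σ k) + 1)^3 = σ (σ r) + (σ (σ r))^2 := by simpa using congrArg σ A1
  have B1 : (σ r + σ (σ r)) * σ k = (σ k + 1)^3 := by simpa using congrArg σ B
  have B2 : (σ (σ r) + σ (σ (σ r))) * σ (σ k) = (σ (σ k) + 1)^3 := by
    simpa using congrArg σ B1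
  have c0 : (σ k + 1)^3 = (k+1)^3 + (r + σ r) + (r + σ r)^2 := by
    rw [A, A1]; linear_combination (-r - r^2 - r * σ r) * h2
  have c1 : (σ (σ k) + 1)^3 = (σ k+1)^3 + (σ r + σ (σ r)) + (σ r + σ (σ r))^2 := by
    rw [A1, A2]; linear_combination (-σ r - (σ r)^2 - σ r * σ (σ r)) * h2
  have e0 : (k+1)^3 = (r + σ r) + (σ r + σ (σ r)) + (σ (σ r) + σ (σ (σ r))) := by
    rw [A, hσ3]; linear_combination (-σ r - σ (σ r)) * h2
  have h64 := core_field k (σ k) (σ (σ k)) _ _ _ hk0 hg0 ((map_ne_zero σ).2 hk0)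
    B B1 B2 c0 c1 e0
  have h4 := gcd_step m hm k h64 (hcard k)
  have hq : k^2 + k + 1 = 0 := by
    have : k * (k+1) * (k^2+k+1) = 0 := by
      linear_combination h4 + (k^3+k^2+k) * h2
    exact (mul_eq_zero.1 this).resolve_left (mul_ne_zero hk0 hg0)
  have hN : (σ k + 1)^3 * k^2 = (k+1)^4 * (k^2+k+1) := by
    linear_combination k^2 * c0 + (k + (r + σ r)*k + (k+1)^3) * B
      + (k + 4*k^2 + 6*k^3 + 4*k^4 + k^5) * h2
  rw [hq, mul_zero] at hN
  have hs : σ k + 1 ≠ 0 := by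
    rw [← map_one σ, ← map_add]; exact (map_ne_zero σ).2 hg0
  exact mul_ne_zero (pow_ne_zero 3 hs) (pow_ne_zero 2 hk0) hN
end

section
/- Let m be a positive integer with m not congruent to 2 modulo 3, let n = 3m, and let d = 2^(2m+1) - 3·2^(m-1) + 1. Then the power function F(x) = x^d over F_{2^n} is 0-APN; that is, (x+1)^d + x^d + 1 = 0 has no solution x in F_{2^n} \ {0,1}. -/
def P0 {F : Type*} [Field F] (x y z : F) : F :=
  y^3*z^4 + x^2*y^3 + x^2*y^2*z^4 + x^2*y*z^4 + x^2*z^4 + y^6 + y^5 + y^4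

structure H {F : Type*} [Field F] (x y z : F) : Prop where
  x0 : x ≠ 0
  y0 : y ≠ 0
  z0 : z ≠ 0
  x1 : x + 1 ≠ 0
  y1 : y + 1 ≠ 0
  z1 : z + 1 ≠ 0
  xy : x + y ≠ 0
  yz : y + z ≠ 0
  zx : z + x ≠ 0
  e1 : P0 x y z = 0
  e2 : P0 y z x = 0
  e3 : P0 z x y = 0

theorem shift0 {F : Type*} [Field F] [CharP F 2] (x y z : F) :
    P0 (x+1) (y+1) (z+1) = P0 x y z := by
  simp only [P0]
  grind

theorem H.rot {F : Type*} [Field F] {x y z : F} (h : H x y z) : H y z x :=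
  ⟨h.y0, h.z0, h.x0, h.y1, h.z1, h.x1, h.yz, h.zx, h.xy, h.e2, h.e3, h.e1⟩

theorem add11 {F : Type*} [Field F] [CharP F 2] (x y : F) : x + 1 + (y + 1) = x + y := by
  grind

theorem add1 {F : Type*} [Field F] [CharP F 2] (x : F) : x + 1 + 1 = x := by
  grind

theorem H.shift {F : Type*} [Field F] [CharP F 2] {x y z : F} (h : H x y z) :
    H (x+1) (y+1) (z+1) := by
  refine ⟨h.x1, h.y1, h.z1, ?_, ?_, ?_, ?_, ?_, ?_, ?_, ?_, ?_⟩
  · rw [add1]; exact h.x0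
  · rw [add1]; exact h.y0
  · rw [add1]; exact h.z0
  · rw [add11]; exact h.xy
  · rw [add11]; exact h.yz
  · rw [add11]; exact h.zx
  · rw [shift0]; exact h.e1
  · rw [shift0]; exact h.e2
  · rw [shift0]; exact h.e3

theorem p0 {F : Type*} [Field F] {x y z : F} (h : H x y z) : P0 x y z = 0 := h.e1

section polys
variable {F : Type*} [Field F] [CharP F 2]

set_option maxHeartbeats 2000000 in
def P1 {F : Type*} [Field F] (x y z : F) : F :=
    x^5*y + x^5*z^2 + x^4*y^2 + x^4*y*z^2 + x^4*y + x^4*z^2 + x^3*y^2*z^4 + x^3*y^2*z^2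
      + x^3*y^2 + x^3*y*z^4 + x^3*y*z^2 + x^3*y + x^3*z^4 + x^3*z^2 + x^2*y^5 + x^2*y^4*z^2
      + x^2*y^3*z^4 + x^2*y^3*z^2 + x^2*y^2*z^2 + x^2*y^2 + x*y^5 + x*y^4*z^2 + x*y^4
      + x*y^3*z^4 + x*y^3*z^2 + x*y^3 + y^4*z^2 + y^3*z^4

set_option maxHeartbeats 2000000 in
theorem q1 (x y z : F) : (x + y) * P1 x y z =
      (x^2 + x) * P0 x y z + (z^2 + y) * P0 z x y := by
  simp only [P1, P0]
  grind

theorem p1 {x y z : F} (h : H x y z) : P1 x y z = 0 := by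
  have e := q1 x y z
  simp only [p0 h,
    p0 (h.rot.rot), mul_zero, add_zero] at e
  exact (mul_eq_zero.1 e).resolve_left h.xy

set_option maxHeartbeats 2000000 in
def P2 {F : Type*} [Field F] (x y z : F) : F :=
    x^5 + x^4*z^2 + x^4 + x^3*y^2 + x^3*z^2 + x^3 + x^2*y^4 + x^2*y^3 + x^2*y^2*z^4
      + x^2*y^2*z^2 + x^2*y^2 + x^2*y*z^4 + x^2*z^4 + x*y^4 + x*y^3 + x*y^2*z^4 + x*y^2*z^2
      + x*y^2 + x*y*z^4 + y^2*z^4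

set_option maxHeartbeats 2000000 in
theorem q2 (x y z : F) : (x + y) * P2 x y z =
      1 * P0 z x y + 1 * P1 x y z := by
  simp only [P2, P0, P1]
  grind

theorem p2 {x y z : F} (h : H x y z) : P2 x y z = 0 := by
  have e := q2 x y z
  simp only [p0 (h.rot.rot),
    p1 h, mul_zero, add_zero] at e
  exact (mul_eq_zero.1 e).resolve_left h.xy

set_option maxHeartbeats 2000000 in
def P3 {F : Type*} [Field F] (x y z : F) : F :=
    x^4 + x^3*y + x^3*z^2 + x^3 + x^2*y*z^2 + x^2*y + x^2*z^2 + x^2 + x*y^4 + x*y*z^2 + x*y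
      + y^5 + y^4 + y^3 + y^2*z^4 + y*z^4

set_option maxHeartbeats 2000000 in
theorem q3 (x y z : F) : (x + y) * P3 x y z =
      1 * P0 x y z + 1 * P2 x y z := by
  simp only [P3, P0, P2]
  grind

theorem p3 {x y z : F} (h : H x y z) : P3 x y z = 0 := by
  have e := q3 x y z
  simp only [p0 h,
    p2 h, mul_zero, add_zero] at e
  exact (mul_eq_zero.1 e).resolve_left h.xy

set_option maxHeartbeats 2000000 in
def P4 {F : Type*} [Field F] (x y z : F) : F :=
    x^5*z + x^5 + x^4*z^2 + x^4*z + x^4 + x^3*y^4*z^2 + x^3*y^4*z + x^3*y^4 + x^3*y^2*z^3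
      + x^3*y^2*z^2 + x^3*y^2*z + x^3*y^2 + x^3*z^4 + x^3*z^2 + x^3*z + x^3 + x^2*y^4*z^2
      + x^2*y^2*z^3 + x*y^4*z^3 + x*y^4*z^2 + x*y^4*z + x*y^4 + x*y^3*z^2 + x*y^3*z + x*y^3
      + x*y^2*z^6 + x*y^2*z^5 + x*y^2*z + x*y^2 + x*y*z^6 + x*y*z^5 + x*y*z^4 + x*z^6 + x*z^5
      + x*z^4 + y^4*z^2 + y^2*z^3 + z^6 + z^5 + z^4

set_option maxHeartbeats 2000000 in
theorem q4 (x y z : F) : (x + 1) * P4 x y z =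
      (y^2 + 1) * P0 y z x + (z + 1) * P0 z x y + (z^2 + z + 1) * P2 x y z := by
  simp only [P4, P0, P2]
  grind

theorem p4 {x y z : F} (h : H x y z) : P4 x y z = 0 := by
  have e := q4 x y z
  simp only [p0 (h.rot),
    p0 (h.rot.rot),
    p2 h, mul_zero, add_zero] at e
  exact (mul_eq_zero.1 e).resolve_left h.x1

set_option maxHeartbeats 2000000 in
def P5 {F : Type*} [Field F] (x y z : F) : F :=
    x^5 + x^4*y + x^4 + x^3*y^2 + x^3*y*z^2 + x^3*y*z + x^3*z^3 + x^3*z^2 + x^3*z + x^3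
      + x^2*y^4 + x^2*y^2*z^4 + x^2*y^2*z^2 + x^2*y^2*z + x^2*y*z^4 + x^2*y*z^3 + x^2*z^4
      + x^2*z^3 + x^2*z + x*y^5 + x*y^4*z + x*y^4 + x*y^2*z^2 + x*y^2 + x*y*z^3 + x*y*z^2
      + x*y*z + x*y + x*z^4 + y^5*z + y^4*z + y^4 + y^3 + y^2*z^5 + y^2*z^4 + y^2*z + y^2
      + y*z^5 + y*z + z^5 + z^4 + z^3

set_option maxHeartbeats 2000000 in
theorem q5 (x y z : F) : (x + y) * P5 x y z =
      (z + 1) * P0 x y z + 1 * P0 y z x + 1 * P0 z x y + 1 * P1 x y z + z * P2 x y z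
        + 1 * P2 y z x + (x*y + y) * P3 x y z + (x + z) * P3 y z x := by
  simp only [P5, P0, P1, P2, P3]
  grind

theorem p5 {x y z : F} (h : H x y z) : P5 x y z = 0 := by
  have e := q5 x y z
  simp only [p0 h,
    p0 (h.rot),
    p0 (h.rot.rot),
    p1 h,
    p2 h,
    p2 (h.rot),
    p3 h,
    p3 (h.rot), mul_zero, add_zero] at e
  exact (mul_eq_zero.1 e).resolve_left h.xy

set_option maxHeartbeats 2000000 in
def P6 {F : Type*} [Field F] (x y z : F) : F :=
    x^5 + x^4*y + x^4*z^2 + x^4*z + x^4 + x^3*y^3*z^2 + x^3*y^3*z + x^3*y^3 + x^3*y^2*z^3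
      + x^3*y^2*z^2 + x^3*y^2*z + x^3*y*z^3 + x^3*y*z^2 + x^3*y*z + x^3*y + x^3*z^3 + x^3*z
      + x^3 + x^2*y^4 + x^2*y^3*z^3 + x^2*y^3*z^2 + x^2*y^3*z + x^2*y^2*z^3 + x^2*y^2
      + x^2*y*z^3 + x^2*y*z + x^2*y + x^2*z^2 + x^2*z + x*y^4 + x*y^3*z^3 + x*y^3*z^2 + x*y^3*z
      + x*y^3 + x*y^2*z^3 + x*y^2*z + x*y^2 + x*y*z^3 + x*y*z^2 + x*y*z + x*z^4 + x*z^3 + x*z^2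
      + y^5 + y^4*z + y^4 + y^3*z^3 + y^3*z + y^3 + y^2*z^4 + y^2*z^2 + y^2*z + y*z^4 + y*z^3
      + y*z^2 + z^5 + z^4 + z^3

set_option maxHeartbeats 2000000 in
theorem q6 (x y z : F) : (x + y) * P6 x y z =
      1 * P0 x y z + 1 * P0 z x y + 1 * P1 y z x + 1 * P1 z x y := by
  simp only [P6, P0, P1]
  grind

theorem p6 {x y z : F} (h : H x y z) : P6 x y z = 0 := by
  have e := q6 x y z
  simp only [p0 h,
    p0 (h.rot.rot),
    p1 (h.rot),
    p1 (h.rot.rot), mul_zero, add_zero] at e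
  exact (mul_eq_zero.1 e).resolve_left h.xy

set_option maxHeartbeats 2000000 in
def P7 {F : Type*} [Field F] (x y z : F) : F :=
    x^5*y + x^5 + x^4*y*z^2 + x^4*y*z + x^4*z + x^4 + x^3*y^2*z^3 + x^3*y^2 + x^3*y*z^3
      + x^3*z^3 + x^3*z + x^3 + x^2*y^5*z^2 + x^2*y^5*z + x^2*y^4*z^2 + x^2*y^4*z + x^2*y^3*z^2
      + x^2*y^3*z + x^2*y^2*z^4 + x^2*y^2*z + x^2*y^2 + x^2*y*z^4 + x^2*y*z^3 + x^2*y + x^2*z^4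
      + x^2*z^3 + x^2*z^2 + x^2*z + x*y^5*z^2 + x*y^5 + x*y^4*z^2 + x*y^4*z + x*y^4 + x*y^3*z^4
      + x*y^3*z + x*y^3 + x*y^2*z^4 + x*y^2*z^3 + x*y^2*z^2 + x*y^2 + x*y*z^4 + x*y*z^2 + x*y*z
      + x*z^4 + y^5*z^2 + y^5*z + y^5 + y^4*z^2 + y^4 + y^3*z^3 + y^3*z^2 + y^3 + y^2*z^4
      + y^2*z^3 + y*z^5 + y*z^4 + y*z^3 + z^5 + z^4 + z^3

set_option maxHeartbeats 2000000 in
theorem q7 (x y z : F) : x * P7 x y z =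
      1 * P0 y z x + (y + 1) * P0 z x y + 1 * P1 x y z + 1 * P1 y z x + (y + 1) * P1 z x y
        + (y*z + y + z) * P2 z x y + y*z * P3 y z x := by
  simp only [P7, P0, P1, P2, P3]
  grind

theorem p7 {x y z : F} (h : H x y z) : P7 x y z = 0 := by
  have e := q7 x y z
  simp only [p0 (h.rot),
    p0 (h.rot.rot),
    p1 h,
    p1 (h.rot),
    p1 (h.rot.rot),
    p2 (h.rot.rot),
    p3 (h.rot), mul_zero, add_zero] at e
  exact (mul_eq_zero.1 e).resolve_left h.x0

set_option maxHeartbeats 2000000 in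
def P8 {F : Type*} [Field F] (x y z : F) : F :=
    x^3*y^4*z^2 + x^3*y^4*z + x^3*y^4 + x^3*y^3*z^3 + x^3*y^3 + x^3*y^2*z^4 + x^3*y^2*z^3
      + x^3*y*z^4 + x^3*y*z^3 + x^3*y*z^2 + x^3*y*z + x^3*y + x^3*z^4 + x^2*y^5*z^2 + x^2*y^5*z
      + x^2*y^5 + x^2*y^4*z^3 + x^2*y^4 + x^2*y^3*z^4 + x^2*y^3*z^3 + x^2*y^2*z^4 + x^2*y^2*z^3
      + x^2*y^2*z^2 + x^2*y*z^4 + x^2*y*z^3 + x^2*z^4 + x^2*z^3 + x*y^5*z^2 + x*y^4*z^2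
      + x*y^3*z^5 + x*y^3*z^3 + x*y^3*z^2 + x*y^2*z^6 + x*y^2*z^5 + x*y^2*z^4 + x*y^2 + x*y*z^6
      + x*y*z^2 + x*y*z + x*z^3 + x*z + y^5*z^3 + y^5*z^2 + y^5*z + y^3*z^6 + y^3*z^4 + y^3*z^2
      + y^3*z + y^3 + y^2*z^6 + y^2 + y*z^3 + y*z^2 + y*z + y + z^6 + z^4 + z^2

set_option maxHeartbeats 2000000 in
theorem q8 (x y z : F) : (x + y) * P8 x y z =
      (x^2 + z) * P0 x y z + (x^2 + y^2 + x) * P0 y z x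
        + (y^2*z^2 + z^3 + y^2 + z^2 + y + 1) * P0 z x y + (y + 1) * P1 x y z
        + (y*z + 1) * P1 y z x + (y^2*z + x*z + z) * P1 z x y
        + (x*y^2 + y^2*z + y*z + z^2 + y + z) * P2 x y z + (y*z^2 + x^2 + x) * P2 y z x
        + (x*y^2*z + x^2*z + y^2*z + x*z + y^2 + y*z + y) * P2 z x y
        + (x*y*z + y*z^2 + z^2 + y + z + 1) * P3 x y z + (y^2*z + x*z + y*z + x) * P3 y z x
        + (x*y^2*z^2 + y*z^2 + y^2 + z) * P3 z x y + 1 * P4 y z x + 1 * P4 z x y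
        + 1 * P4 (x + 1) (y + 1) (z + 1) := by
  simp only [P8, P0, P1, P2, P3, P4]
  grind

theorem p8 {x y z : F} (h : H x y z) : P8 x y z = 0 := by
  have e := q8 x y z
  simp only [p0 h,
    p0 (h.rot),
    p0 (h.rot.rot),
    p1 h,
    p1 (h.rot),
    p1 (h.rot.rot),
    p2 h,
    p2 (h.rot),
    p2 (h.rot.rot),
    p3 h,
    p3 (h.rot),
    p3 (h.rot.rot),
    p4 (h.rot),
    p4 (h.rot.rot),
    p4 (h.shift), mul_zero, add_zero] at e
  exact (mul_eq_zero.1 e).resolve_left h.xy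

set_option maxHeartbeats 2000000 in
def P9 {F : Type*} [Field F] (x y z : F) : F :=
    x^5*y*z + x^5*z + x^5 + x^4*y^2*z + x^4*y + x^4*z^2 + x^4 + x^3*y^4*z^3 + x^3*y^4*z^2
      + x^3*y^4*z + x^3*y^3*z^4 + x^3*y^3*z + x^3*y^2*z^4 + x^3*y^2*z^2 + x^3*y^2*z + x^3*y*z^4
      + x^3*y + x^3*z^3 + x^3*z + x^3 + x^2*y^5*z^3 + x^2*y^5*z^2 + x^2*y^4*z^4 + x^2*y^4*z^2
      + x^2*y^4*z + x^2*y^3*z^4 + x^2*y^3*z^2 + x^2*y^3 + x^2*y^2*z^5 + x^2*y^2*z^3 + x^2*y^2*z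
      + x^2*y*z^5 + x^2*y*z^2 + x^2*y*z + x^2*y + x^2*z^5 + x^2*z^4 + x*y^5*z^3 + x*y^5*z^2
      + x*y^5*z + x*y^5 + x*y^4*z^4 + x*y^4*z^2 + x*y^4 + x*y^3*z^4 + x*y^3*z^3 + x*y^3*z
      + x*y^2*z^4 + x*y^2*z^2 + x*y^2 + x*y*z^5 + x*y*z^3 + x*y*z^2 + x*y*z + x*z^4 + x*z^3
      + x*z^2 + y^5*z^3 + y^5*z^2 + y^4*z^4 + y^4*z^3 + y^4*z + y^4 + y^3*z^5 + y^3*z^4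
      + y^3*z^2 + y^3*z + y^3 + y^2*z^4 + y^2*z^2 + y^2*z + y^2 + y*z^5 + z^5 + z^4 + z^3

set_option maxHeartbeats 2000000 in
theorem q9 (x y z : F) : (x + y) * P9 x y z =
      (x*z + x) * P0 x y z + 1 * P0 y z x + (y*z + z + 1) * P0 z x y + (y*z + z) * P1 y z x
        + (y*z + 1) * P1 z x y + (y + z) * P2 x y z + (z^2 + 1) * P2 y z x
        + (x*y*z + y^2*z + y*z + y) * P2 z x y + (y*z + x) * P3 y z x + (z^2 + y) * P3 z x y := by
  simp only [P9, P0, P1, P2, P3]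
  grind

theorem p9 {x y z : F} (h : H x y z) : P9 x y z = 0 := by
  have e := q9 x y z
  simp only [p0 h,
    p0 (h.rot),
    p0 (h.rot.rot),
    p1 (h.rot),
    p1 (h.rot.rot),
    p2 h,
    p2 (h.rot),
    p2 (h.rot.rot),
    p3 (h.rot),
    p3 (h.rot.rot), mul_zero, add_zero] at e
  exact (mul_eq_zero.1 e).resolve_left h.xy

set_option maxHeartbeats 2000000 in
def P10 {F : Type*} [Field F] (x y z : F) : F :=
    x^5*z + x^4*y*z + x^4*z^2 + x^3*y^4*z^2 + x^3*y^4*z + x^3*y^4 + x^3*y^3*z^3 + x^3*y^3*z^2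
      + x^3*y^3*z + x^3*y^2*z^4 + x^3*y^2*z^3 + x^3*y^2*z + x^3*y*z^4 + x^3*z^4 + x^3*z^3
      + x^2*y^5*z^2 + x^2*y^5*z + x^2*y^5 + x^2*y^4*z^3 + x^2*y^4*z + x^2*y^4 + x^2*y^3*z^4
      + x^2*y^3*z^3 + x^2*y^3*z + x^2*y^3 + x^2*y^2*z^2 + x^2*y*z^3 + x^2*y*z^2 + x^2*y*z
      + x^2*y + x*y^5*z^2 + x*y^5*z + x*y^4*z^3 + x*y^4*z^2 + x*y^4*z + x*y^3*z^2 + x*y^3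
      + x*y^2*z^4 + x*y^2*z^3 + x*y^2*z^2 + x*y^2*z + x*y*z^4 + x*y*z^3 + x*y*z^2 + x*y + x*z^5
      + x*z^4 + x*z^3 + x*z^2 + x*z + y^5 + y^4*z^2 + y^4 + y^3*z^5 + y^3*z^4 + y^3 + y^2*z^5
      + y^2*z^2 + y*z^5 + z^4 + z^3 + z^2

set_option maxHeartbeats 2000000 in
theorem q10 (x y z : F) : (x + y) * P10 x y z =
      (x^3 + x*z + x + z) * P0 x y z + (x^2 + y^2 + x + y + 1) * P0 y z x
        + (y^2*z + y^2 + y*z + z + 1) * P0 z x y + 1 * P1 x y z + (x*z + y*z + 1) * P1 y z x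
        + (x*y^2 + y*z) * P2 x y z + (x^2 + z^2 + 1) * P2 y z x
        + (x*y*z + y^2*z + x*z + y^2 + 1) * P2 z x y
        + (x^2*y + x*y*z + y*z^2 + y*z + y) * P3 x y z
        + (x^2*y*z + x^2*z + x*y*z + x) * P3 y z x
        + (x*y*z^2 + x*z^2 + y^2*z + y^2 + y*z + z^2 + y) * P3 z x y + 1 * P4 x y z
        + (x + 1) * P4 z x y + 1 * P4 (x + 1) (y + 1) (z + 1) + 1 * P4 (y + 1) (z + 1) (x + 1)
        + (x + 1) * P4 (z + 1) (x + 1) (y + 1) + (x*y*z + x) * P5 y z x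
        + (x*y*z + x*z + y + z) * P5 z x y + (x*y*z + y*z + z) * P6 x y z + (y + z) * P7 x y z
        + 1 * P7 y z x + 1 * P7 z x y + (y + z) * P7 (x + 1) (y + 1) (z + 1) := by
  simp only [P10, P0, P1, P2, P3, P4, P5, P6, P7]
  grind

theorem p10 {x y z : F} (h : H x y z) : P10 x y z = 0 := by
  have e := q10 x y z
  simp only [p0 h,
    p0 (h.rot),
    p0 (h.rot.rot),
    p1 h,
    p1 (h.rot),
    p2 h,
    p2 (h.rot),
    p2 (h.rot.rot),
    p3 h,
    p3 (h.rot),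
    p3 (h.rot.rot),
    p4 h,
    p4 (h.rot.rot),
    p4 (h.shift),
    p4 ((h.rot).shift),
    p4 ((h.rot.rot).shift),
    p5 (h.rot),
    p5 (h.rot.rot),
    p6 h,
    p7 h,
    p7 (h.rot),
    p7 (h.rot.rot),
    p7 (h.shift), mul_zero, add_zero] at e
  exact (mul_eq_zero.1 e).resolve_left h.xy

set_option maxHeartbeats 2000000 in
def P11 {F : Type*} [Field F] (x y z : F) : F :=
    x^5*y^4*z + x^5*y^3*z^4 + x^5*y^3*z^2 + x^5*y^3*z + x^5*y^2*z^6 + x^5*y^2*z^5 + x^5*y^2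
      + x^5*y*z^6 + x^5*y*z^5 + x^5*y*z^4 + x^5*y*z^3 + x^5*z^6 + x^5*z^5 + x^5*z + x^4*y^5*z
      + x^4*y^4*z^4 + x^4*y^4*z^3 + x^4*y^4*z^2 + x^4*y^4*z + x^4*y^4 + x^4*y^3*z^6
      + x^4*y^3*z^5 + x^4*y^3*z^3 + x^4*y^3*z^2 + x^4*y^3 + x^4*y^2*z + x^4*y*z^4 + x^4*y*z^2
      + x^4*y*z + x^4*z^6 + x^4*z^5 + x^4*z^3 + x^4*z^2 + x^3*y^5*z^4 + x^3*y^5*z^2 + x^3*y^5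
      + x^3*y^4*z^6 + x^3*y^4*z^5 + x^3*y^4*z^4 + x^3*y^4 + x^3*y^3*z^6 + x^3*y^3*z^3
      + x^3*y^3*z^2 + x^3*y^3*z + x^3*y^3 + x^3*y^2*z^6 + x^3*y^2*z^3 + x^3*y^2*z + x^3*y
      + x^3*z^6 + x^3*z^5 + x^3*z^4 + x^3*z^3 + x^3*z^2 + x^2*y^5*z^6 + x^2*y^5*z + x^2*y^4*z^4
      + x^2*y^4*z^3 + x^2*y^4*z + x^2*y^3*z^3 + x^2*y^3*z + x^2*y^2*z^6 + x^2*y^2*z^5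
      + x^2*y*z^6 + x^2*y*z^4 + x^2*y*z^3 + x^2*y*z^2 + x^2*y + x^2*z^6 + x^2*z^5 + x^2*z^3
      + x^2*z^2 + x^2*z + x*y^5*z^6 + x*y^5*z^4 + x*y^5*z^3 + x*y^5 + x*y^4*z^3 + x*y^4*z^2
      + x*y^3*z^4 + x*y^3*z^2 + x*y^2*z^6 + x*y^2*z^5 + x*y^2*z^4 + x*y^2*z^2 + x*y*z^4
      + x*y*z^2 + x*y*z + x*y + x*z^6 + x*z^3 + y^5*z^6 + y^4*z^6 + y^4*z^5 + y^4*z^3 + y^4*z^2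
      + y^4*z + y^3*z^6 + y^3*z^5 + y^3*z^4 + y^3*z + y^2*z^4 + y^2*z^3 + y^2*z + y*z^6 + y*z^5
      + z^5 + z^4 + z^3

set_option maxHeartbeats 2000000 in
theorem q11 (x y z : F) : (x + y) * P11 x y z =
      (x^4*z^2 + x^2*z + x*z^2 + z) * P0 x y z + (x*y^2 + 1) * P0 y z x
        + (y^2*z^4 + y^2*z^3 + y*z^3 + y^2*z + y*z^2 + z^3) * P0 z x y
        + (x^2*y*z + y*z + z) * P1 y z x + (z + 1) * P1 z x y + (x^2*y*z^2 + z) * P2 y z x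
        + (x*z + y*z + z) * P2 z x y + y * P3 x y z + x^2 * P4 z x y + y^3 * P8 y z x
        + x*z^3 * P8 z x y + (y^3*z + y^3) * P8 (y + 1) (z + 1) (x + 1) + x*y*z * P9 y z x := by
  simp only [P11, P0, P1, P2, P3, P4, P8, P9]
  grind

theorem p11 {x y z : F} (h : H x y z) : P11 x y z = 0 := by
  have e := q11 x y z
  simp only [p0 h,
    p0 (h.rot),
    p0 (h.rot.rot),
    p1 (h.rot),
    p1 (h.rot.rot),
    p2 (h.rot),
    p2 (h.rot.rot),
    p3 h,
    p4 (h.rot.rot),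
    p8 (h.rot),
    p8 (h.rot.rot),
    p8 ((h.rot).shift),
    p9 (h.rot), mul_zero, add_zero] at e
  exact (mul_eq_zero.1 e).resolve_left h.xy

set_option maxHeartbeats 2000000 in
theorem qt (x y z : F) : (x*y+x+1)*(x*y+y+1) =
      (x*z^2 + x^2 + x*z + z + 1) * P0 x y z + (x*y^2 + y^3 + x^2 + x + 1) * P0 y z x
        + (z^4 + y*z^2 + y^2 + y*z + z^2 + 1) * P0 z x y + (x*y + z^2 + y + z + 1) * P1 x y z
        + (y*z + x + z) * P1 y z x + y^2 * P1 z x y + (y^2*z^2 + x*y^2 + y*z + z^2) * P2 x y z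
        + (x^2*z + x*z^2 + y*z^2 + x*z) * P2 y z x + (x^2*z + y^2 + z + 1) * P2 z x y
        + (x*y*z^2 + y*z^2 + y*z) * P3 x y z
        + (x^2*y^2*z + x^2*y*z + x*y^2*z + x^2*z + y^2*z + x + 1) * P3 y z x
        + (x*y*z^2 + y^2*z^2 + x*z^2 + y*z^2 + z^2 + z + 1) * P3 z x y + (y + 1) * P4 x y z
        + 1 * P4 y z x + y * P4 (x + 1) (y + 1) (z + 1) + (z + 1) * P4 (y + 1) (z + 1) (x + 1)
        + (x + 1) * P4 (z + 1) (x + 1) (y + 1) + y*z * P5 x y z + (y*z + x) * P5 y z x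
        + (x*z + y*z + z + 1) * P5 z x y + 1 * P6 x y z + (y*z + y + 1) * P7 x y z
        + (x*z + 1) * P7 y z x + y * P7 z x y + y*z * P7 (x + 1) (y + 1) (z + 1)
        + (x*z + z + 1) * P7 (y + 1) (z + 1) (x + 1) + (y + 1) * P7 (z + 1) (x + 1) (y + 1)
        + (y^3 + y^2*z + z + 1) * P8 y z x + (x*z^2 + z^3 + z + 1) * P8 z x y
        + 1 * P8 (x + 1) (y + 1) (z + 1) + (y^3 + y^2*z) * P8 (y + 1) (z + 1) (x + 1)
        + (x*z^2 + z^3 + 1) * P8 (z + 1) (x + 1) (y + 1) + (z + 1) * P10 x y z + 1 * P10 y z x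
        + 1 * P10 z x y + z * P10 (x + 1) (y + 1) (z + 1) + 1 * P10 (y + 1) (z + 1) (x + 1)
        + 1 * P10 (z + 1) (x + 1) (y + 1) + 1 * P11 x y z + 1 * P11 (x + 1) (y + 1) (z + 1) := by
  simp only [P0, P1, P2, P3, P4, P5, P6, P7, P8, P10, P11]
  grind

theorem pt {x y z : F} (h : H x y z) : (x*y+x+1)*(x*y+y+1) = 0 := by
  have e := qt x y z
  simpa only [p0 h,
    p0 (h.rot),
    p0 (h.rot.rot),
    p1 h,
    p1 (h.rot),
    p1 (h.rot.rot),
    p2 h,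
    p2 (h.rot),
    p2 (h.rot.rot),
    p3 h,
    p3 (h.rot),
    p3 (h.rot.rot),
    p4 h,
    p4 (h.rot),
    p4 (h.shift),
    p4 ((h.rot).shift),
    p4 ((h.rot.rot).shift),
    p5 h,
    p5 (h.rot),
    p5 (h.rot.rot),
    p6 h,
    p7 h,
    p7 (h.rot),
    p7 (h.rot.rot),
    p7 (h.shift),
    p7 ((h.rot).shift),
    p7 ((h.rot.rot).shift),
    p8 (h.rot),
    p8 (h.rot.rot),
    p8 (h.shift),
    p8 ((h.rot).shift),
    p8 ((h.rot.rot).shift),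
    p10 h,
    p10 (h.rot),
    p10 (h.rot.rot),
    p10 (h.shift),
    p10 ((h.rot).shift),
    p10 ((h.rot.rot).shift),
    p11 h,
    p11 (h.shift), mul_zero, add_zero] using e

end polys

theorem fin_case {F : Type*} [Field F] [CharP F 2] (m : ℕ) (hm3 : m % 3 ≠ 2) (x y z : F)
    (hx0 : x ≠ 0) (hx1 : x + 1 ≠ 0) (hy0 : y ≠ 0)
    (hy : x ^ (2^m) = y) (h0 : P0 x y z = 0) (h1 : x*y+x+1 = 0) (h2 : y*z+y+1 = 0) : False := by
  have f : x^12+x^11+x^8+x^6+x^4+x^3+x^2+x+1 = 0 := by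
    have ey : y = (x+1)/x := by
      rw [eq_div_iff hx0]; grind
    have ez : z = 1/(x+1) := by
      rw [eq_div_iff hx1]
      have : y * (z * (x+1) - 1) = 0 := by grind
      have := (mul_eq_zero.1 this).resolve_left hy0
      exact sub_eq_zero.1 this
    have e : P0 x y z * (x^6*(x+1)^4) = x^12+x^11+x^8+x^6+x^4+x^3+x^2+x+1 := by
      rw [ey, ez]; simp only [P0]; field_simp
      grind
    rw [← e, h0, zero_mul]
  obtain ⟨u, hu⟩ : ∃ u, u = x^7+x^6+x^3+x^2+1 := ⟨_, rfl⟩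
  have u3 : u^3 + u + 1 = 0 := by
    subst hu; clear hy h0 h1 h2; grind
  have u8 : u^8 = u := by
    clear hu f hy h0 h1 h2; grind
  have uy : u^(2^m) = y^7+y^6+y^3+y^2+1 := by
    have := congrArg (iterateFrobenius F 2 m) hu
    simp only [map_add, map_pow, map_one, iterateFrobenius_def] at this
    rw [hy] at this
    exact this
  have uy4 : u^(2^m) = u^4 := by
    rw [uy]
    have e : x^7 * (y^7+y^6+y^3+y^2+1)
        = (x*y)^7+(x*y)^6*x+(x*y)^3*x^4+(x*y)^2*x^5+x^7 := by ring
    have exy : x*y = x+1 := by grind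
    rw [exy] at e
    have : x^7 * (y^7+y^6+y^3+y^2+1) = x^7 * u^4 := by
      rw [e, hu]; clear e exy hu u3 u8 uy hy h0 h1 h2; grind
    exact mul_left_cancel₀ (pow_ne_zero _ hx0) this
  have key : ∀ k : ℕ, u^(8^k) = u := by
    intro k
    induction k with
    | zero => simp
    | succ k ih => rw [pow_succ, pow_mul, ih, u8]
  have um : u^(2^m) = u^(2^(m%3)) := by
    conv_lhs => rw [← Nat.div_add_mod m 3, pow_add, pow_mul 2 3, pow_mul u]
    norm_num
    rw [key]
  have hr : m % 3 = 0 ∨ m % 3 = 1 := by omega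
  rw [um] at uy4
  have hu0 : u ≠ 0 := by rintro rfl; simp at u3
  clear hu f hy h0 h1 h2 um key uy u8
  rcases hr with hr | hr <;> rw [hr] at uy4
  · norm_num at uy4
    have : (1:F) = 0 := by grind
    exact one_ne_zero this
  · norm_num at uy4
    have : (1:F) = 0 := by grind
    exact one_ne_zero this

theorem eqn {F : Type*} [Field F] (m : ℕ) (hm : 0 < m) (x : F) :
    (x ^ (2^(2*m+1)-3*2^(m-1)+1))^2 * (x^(2^m))^3 = ((x^(2^m))^(2^m))^4 * x^2 := by
  obtain ⟨k, rfl⟩ : ∃ k, m = k+1 := ⟨m-1, by omega⟩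
  have h : 3*2^k ≤ 2^(2*(k+1)+1) := by
    have h1 : 2^(2*(k+1)+1) = 8 * (2^k * 2^k) := by ring
    have : 1 ≤ 2^k := Nat.one_le_two_pow
    rw [h1]; nlinarith
  simp only [Nat.add_sub_cancel]
  obtain ⟨c, hc⟩ := Nat.exists_eq_add_of_le h
  rw [hc, Nat.add_sub_cancel_left]
  simp only [← pow_mul, ← pow_add]
  congr 1
  have h1 : 2^(2*(k+1)+1) = 8 * (2^k * 2^k) := by ring
  have h2 : 2^(k+1) = 2 * 2^k := by ring
  rw [h1] at hc
  have h3 : 2^(k+1+(k+1)) = 4 * (2^k * 2^k) := by ring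
  rw [h2, h3]
  omega

theorem zero_apn_4 (m : ℕ) (hm : 0 < m) (hm3 : m % 3 ≠ 2)
    (x : GaloisField 2 (3*m)) (hx0 : x ≠ 0) (hx1 : x ≠ 1) :
    (x + 1) ^ (2^(2*m+1)-3*2^(m-1)+1) + x ^ (2^(2*m+1)-3*2^(m-1)+1) + 1 ≠ 0 := by
  intro h
  have hx1' : x + 1 ≠ 0 := by
    intro h; apply hx1; grind
  have ha := eqn m hm x
  have hb := eqn m hm (x+1)
  have fr : ∀ t : GaloisField 2 (3*m), (t+1)^(2^m) = t^(2^m) + 1 := by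
    intro t; rw [add_pow_char_pow, one_pow]
  rw [fr, fr] at hb
  have hx3 : ((x^(2^m))^(2^m))^(2^m) = x := by
    rw [← pow_mul, ← pow_mul, ← pow_add, ← pow_add]
    have : Fintype (GaloisField 2 (3*m)) := Fintype.ofFinite _
    have hc := FiniteField.pow_card x
    rw [← Nat.card_eq_fintype_card, GaloisField.card 2 (3*m) (by omega)] at hc
    rw [show m + (m + m) = 3*m by ring]; exact hc
  generalize (x + 1) ^ (2^(2*m+1)-3*2^(m-1)+1) = b at *
  generalize x ^ (2^(2*m+1)-3*2^(m-1)+1) = a at *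
  obtain ⟨y, hy⟩ : ∃ y, x^(2^m) = y := ⟨_, rfl⟩
  obtain ⟨z, hz⟩ : ∃ z, y^(2^m) = z := ⟨_, rfl⟩
  rw [hy, hz] at ha hb hx3
  have frP : ∀ s t w : GaloisField 2 (3*m), P0 s t w = 0 →
      P0 (s^(2^m)) (t^(2^m)) (w^(2^m)) = 0 := by
    intro s t w h
    have := congrArg (iterateFrobenius _ 2 m) h
    simp only [P0, map_add, map_mul, map_pow, map_zero, iterateFrobenius_def] at this
    exact this
  have e1 : P0 x y z = 0 := by
    have h2 : a^2 + b^2 + 1 = 0 := by grind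
    have : P0 x y z = y^3*(y+1)^3*(a^2+b^2+1) + (y+1)^3 * (a^2*y^3 - z^4*x^2)
        + y^3*(b^2*(y+1)^3 - (z+1)^4*(x+1)^2) := by
      simp only [P0]; clear ha hb h h2 hy hz hx3 frP fr; grind
    rw [this, h2, ha, hb]; simp
  have e2 := frP _ _ _ e1
  rw [hy, hz, hx3] at e2
  have e3 := frP _ _ _ e2
  rw [hy, hz, hx3] at e3
  have hy0 : y ≠ 0 := hy ▸ pow_ne_zero _ hx0
  have hz0 : z ≠ 0 := hz ▸ pow_ne_zero _ hy0
  have hy1 : y + 1 ≠ 0 := by rw [← hy, ← fr]; exact pow_ne_zero _ hx1'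
  have hz1 : z + 1 ≠ 0 := by rw [← hz, ← fr]; exact pow_ne_zero _ hy1
  have hxy : x + y ≠ 0 := by
    intro hh
    have e : y = x := by clear e1 e2 e3 ha hb; grind
    subst e
    have e : z = y := by rw [← hz, hy]
    subst e
    have : P0 z z z = z^4*(z+1)^4 := by
      simp only [P0]; clear e1 e2 e3 ha hb hx3 hz hy fr frP; grind
    rw [this] at e1
    exact mul_ne_zero (pow_ne_zero _ hx0) (pow_ne_zero _ hx1') e1
  have hyz : y + z ≠ 0 := by
    rw [← hz, ← hy, ← add_pow_char_pow, hy]; exact pow_ne_zero _ hxy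
  have hzx : z + x ≠ 0 := by
    rw [← hx3, ← hz, ← add_pow_char_pow, hz]; exact pow_ne_zero _ hyz
  have hH : H x y z := ⟨hx0, hy0, hz0, hx1', hy1, hz1, hxy, hyz, hzx, e1, e2, e3⟩
  rcases mul_eq_zero.1 (pt hH) with h1 | h1
  · refine fin_case m hm3 x y z hx0 hx1' hy0 hy e1 h1 ?_
    have := congrArg (iterateFrobenius _ 2 m) h1
    simp only [map_add, map_mul, map_one, map_zero, iterateFrobenius_def] at this
    rwa [hy, hz] at this
  · have h2 : y*z+z+1 = 0 := by
      have := congrArg (iterateFrobenius _ 2 m) h1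
      simp only [map_add, map_mul, map_one, map_zero, iterateFrobenius_def] at this
      rwa [hy, hz] at this
    refine fin_case m hm3 (x+1) (y+1) (z+1) hx1' (by rw [add1]; exact hx0) hy1
      (by rw [fr, hy]) (by rw [shift0]; exact e1) ?_ ?_
    · clear e1 e2 e3 ha hb hx3 hz hy fr frP; grind
    · clear e1 e2 e3 ha hb hx3 hz hy fr frP; grind
end

section
/- Let m be a positive integer, n = 4m-1, and d = 2^(2m-1) - 2^(m-1) - 1. Then the power function F(x) = x^d over F_{2^n} is 0-APN; that is, (x+1)^d + x^d + 1 = 0 has no solution x in F_{2^n} \ {0,1}. -/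
namespace ZApn

/-- carry-less product with fuel -/
def clF : ℕ → ℕ → ℕ → ℕ
  | 0, _, _ => 0
  | f + 1, x, y => if x % 2 = 1 then y ^^^ (2 * clF f (x / 2) y) else 2 * clF f (x / 2) y

/-- carry-less product -/
def cl (x y : ℕ) : ℕ := clF (Nat.log2 x + 1) x y

/-- carry-less power -/
def pw (x : ℕ) : ℕ → ℕ
  | 0 => 1
  | k + 1 => cl x (pw x k)

def padd : List ℕ → List ℕ → List ℕ
  | [], q => q
  | p, [] => p
  | c :: p, d :: q => (c ^^^ d) :: padd p q

def pmul : List ℕ → List ℕ → List ℕ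
  | [], _ => []
  | c :: p, q => padd (q.map (cl c)) (0 :: pmul p q)

section
variable {K : Type*} [Field K]

/-- evaluation of a bit mask as a polynomial over the field with two elements -/
def ev (a : K) (n : ℕ) : K :=
  if h : n = 0 then 0 else ((n % 2 : ℕ) : K) + a * ev a (n / 2)
termination_by n
decreasing_by omega

def ev2 (a e : K) : List ℕ → K
  | [] => 0
  | c :: p => ev a c + e * ev2 a e p

theorem ev_zero (a : K) : ev a 0 = 0 := by rw [ev]; simp

theorem ev_step (a : K) (n : ℕ) : ev a n = ((n % 2 : ℕ) : K) + a * ev a (n / 2) := by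
  by_cases h : n = 0
  · subst h; simp [ev_zero]
  · conv_lhs => rw [ev]
    simp [h]

theorem ev_one (a : K) : ev a 1 = 1 := by rw [ev_step]; simp [ev_zero]

theorem ev_double (a : K) (n : ℕ) : ev a (2 * n) = a * ev a n := by
  rw [ev_step]; simp

theorem ev_two (a : K) : ev a 2 = a := by
  have := ev_double a 1
  simpa [ev_one] using this

theorem ev_xor [CharP K 2] (a : K) : ∀ x y : ℕ, ev a (x ^^^ y) = ev a x + ev a y := by
  intro x
  induction x using Nat.strong_induction_on with
  | _ x ih =>
    intro y
    by_cases hx : x = 0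
    · subst hx; simp [ev_zero]
    · rw [ev_step a (x ^^^ y), ev_step a x, ev_step a y, Nat.xor_div_two, ih (x / 2) (by omega)]
      have h2 : (2 : K) = 0 := CharTwo.two_eq_zero
      have : (((x ^^^ y) % 2 : ℕ) : K) = ((x % 2 : ℕ) : K) + ((y % 2 : ℕ) : K) := by
        rw [Nat.xor_mod_two_eq, ← Nat.cast_add]
        rcases Nat.mod_two_eq_zero_or_one x with h | h <;>
          rcases Nat.mod_two_eq_zero_or_one y with h' | h' <;>
          simp [Nat.add_mod, h, h', h2]
      rw [this]; ring

theorem ev_clF [CharP K 2] (a : K) (f : ℕ) :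
    ∀ x y : ℕ, x < 2 ^ f → ev a (clF f x y) = ev a x * ev a y := by
  induction f with
  | zero => intro x y h; have : x = 0 := by simpa using h
            subst this; simp [clF, ev_zero]
  | succ f ih =>
    intro x y h
    have h' : x / 2 < 2 ^ f := by rw [pow_succ] at h; omega
    rw [clF, ev_step a x]
    split_ifs with hx
    · rw [ev_xor, ev_double, ih _ _ h', hx]; push_cast; ring
    · have : x % 2 = 0 := by omega
      rw [ev_double, ih _ _ h', this]; push_cast; ring

theorem ev_cl [CharP K 2] (a : K) (x y : ℕ) : ev a (cl x y) = ev a x * ev a y :=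
  ev_clF a _ x y Nat.lt_log2_self

theorem ev_pw [CharP K 2] (a : K) (x k : ℕ) : ev a (pw x k) = ev a x ^ k := by
  induction k with
  | zero => simp [pw, ev_one]
  | succ k ih => rw [pw, ev_cl, ih]; ring

theorem ev2_padd [CharP K 2] (a e : K) : ∀ p q, ev2 a e (padd p q) = ev2 a e p + ev2 a e q
  | [], q => by simp [padd, ev2]
  | c :: p, [] => by simp [padd, ev2]
  | c :: p, d :: q => by
    simp only [padd, ev2, ev_xor, ev2_padd a e p q]; ring

theorem ev2_map [CharP K 2] (a e : K) (c : ℕ) : ∀ q, ev2 a e (q.map (cl c)) = ev a c * ev2 a e q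
  | [] => by simp [ev2]
  | d :: q => by
    simp only [List.map, ev2, ev_cl, ev2_map a e c q]; ring

theorem ev2_pmul [CharP K 2] (a e : K) : ∀ p q, ev2 a e (pmul p q) = ev2 a e p * ev2 a e q
  | [], q => by simp [pmul, ev2]
  | c :: p, q => by
    simp only [pmul, ev2_padd, ev2, ev2_map, ev2_pmul a e p q, ev_zero]; ring

theorem ev2_all (a e : K) : ∀ p : List ℕ, p.all (fun c => c == 0) = true → ev2 a e p = 0
  | [], _ => rfl
  | c :: p, h => by
    simp only [List.all_cons, Bool.and_eq_true, beq_iff_eq] at h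
    rw [ev2, ev2_all a e p h.2, h.1, ev_zero]; ring

theorem ev2_eq [CharP K 2] (a e : K) (p q : List ℕ)
    (h : (padd p q).all (fun c => c == 0) = true) : ev2 a e p = ev2 a e q := by
  have := ev2_all a e _ h
  rw [ev2_padd] at this
  exact CharTwo.add_eq_zero.mp this

end

def lE : List ℕ := [0, 1]
def lA : List ℕ := [2]
def lA2 : List ℕ := [4]
def lB : List ℕ := pmul lE (pmul lA (padd (pmul lE lA) (padd lA lE)))
def lQ : List ℕ := padd lE (padd lA [1])
def lN : List ℕ := pmul lA2 (pmul lB (padd (pmul [5] lB) (pmul lA2 lQ)))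
def lD : List ℕ := pmul lQ (padd lB (pmul [5] lQ))
def lB2 : List ℕ := pmul lB lB
def lQ2 : List ℕ := pmul lQ lQ
def lN2 : List ℕ := pmul lN lN
def lD2 : List ℕ := pmul lD lD
def lF2 : List ℕ := padd
  (pmul lE (pmul (padd (pmul lB2 lD) (padd (pmul lN lQ2) (pmul lQ2 lD))) (pmul lQ2 lD)))
  (pmul (pmul lB2 lN) (padd (pmul lB2 lN) (padd (pmul lN lQ2) (pmul lB2 lD))))
def lF3 : List ℕ := padd
  (pmul lA2 (pmul (padd lN2 (padd (pmul lE lD2) lD2)) lD2))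
  (pmul (pmul lN2 lE) (padd (pmul lN2 lE) (padd (pmul lE lD2) lN2)))
def lE2 : List ℕ := [4369, 53713, 94321,
   1102033, 1945697, 441345,
   833297, 18316753, 17947232,
   16808640, 17570672, 18224656,
   18619648, 18290176, 17895424]
def lE3 : List ℕ := [21845, 21845, 1052672,
   0, 4199680, 20972800,
   21303552, 0, 4277253,
   335630341, 335827008, 0,
   1119312, 1310800, 1376320,
   0, 65792, 357908480,
   357908480]
def lU : List ℕ := [475308386637387304428057630087018017803, 3126961182301513349855828885798244162744, 3594380403903876456814578442121802239704,
   21369224428920143952996211218885687837560, 54096901820947675173142875141074736175768, 37344383061886826516386858886329515909048,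
   32018364374432293400001246437940013179096, 133199476230616554928300790662795867136888, 1027400129674163340420299435461478728278819,
   683658967907284977770130243492787185082496, 139430689440789952237779993474954562905920, 167455977623996866015628589985382078944064,
   141826407813494454586407890319711042399472, 171882432409657538172809882429258025748672, 166895450332700288194420475463648753370880,
   42885407449015634008219582480916113252096, 946018433769367466231341978229149494280192, 555689134556783852052018412816328716238848]
def lV : List ℕ := [107913017820900842001422530899365048663, 570108327205368452926252563545250826648, 2974601720438217863330317987377066704143,
   706066604113187298641585180595233275104, 393296998600642539639609270419891336807, 9991607398198143081044245867020578327960,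
   50714633896595314828834064668497187788207, 43225207327313342246173089002254145194432, 44710475676096172893953531677044984332000,
   34773126036601907658803711622691241879456, 49492343061118169684509962135440982183664, 42884961017837509940472638350352033560832,
   48773054947901353585032040255367093764608, 40862016810392897574543537222912271642624]

theorem chk2 : (padd lF2 (pmul (pmul lE (padd lE [1])) lE2)).all (fun c => c == 0) = true := by
  decide +kernel
theorem chk3 : (padd lF3 (pmul [20] lE3)).all (fun c => c == 0) = true := by
  decide +kernel
theorem chkR : (padd (padd (pmul lU lE2) (pmul lV lE3))
    [cl (cl (pw 2 24) (pw 3 24)) (cl (pw 7 29) (pw 2 32 ^^^ 2))]).all (fun c => c == 0) = true := by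
  decide +kernel
theorem chkF : (padd [cl 264254048 (pw 2 14 ^^^ (pw 2 11 ^^^ (pw 2 10 ^^^ (pw 2 4 ^^^ (pw 2 3 ^^^ 1)))))]
    [cl 1891 (pw 2 31 ^^^ 1) ^^^ 3]).all (fun c => c == 0) = true := by
  decide +kernel

section
variable {K : Type*} [Field K] [CharP K 2]

theorem ev_three (a : K) : ev a 3 = a + 1 := by
  rw [show 3 = 2 ^^^ 1 from rfl, ev_xor, ev_two, ev_one]
theorem ev_four (a : K) : ev a 4 = a ^ 2 := by
  rw [show 4 = pw 2 2 from by decide +kernel, ev_pw, ev_two]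
theorem ev_five (a : K) : ev a 5 = a ^ 2 + 1 := by
  rw [show 5 = 4 ^^^ 1 from rfl, ev_xor, ev_four, ev_one]
theorem ev_seven (a : K) : ev a 7 = a ^ 2 + (a + 1) := by
  rw [show 7 = 4 ^^^ 3 from rfl, ev_xor, ev_four, ev_three]
theorem ev_twenty (a : K) : ev a 20 = a ^ 2 * (a + 1) ^ 2 := by
  rw [show 20 = cl (pw 2 2) (pw 3 2) from by decide +kernel, ev_cl, ev_pw, ev_pw, ev_two, ev_three]

theorem elim (a b c e : K)
    (h1 : c * (b + (a ^ 2 + 1)) = a ^ 2 * (b * ((a ^ 2 + 1) * b + a ^ 2)))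
    (h2 : e * (b ^ 2 + c + 1) + b ^ 2 * c * (b ^ 2 * c + c + b ^ 2) = 0)
    (h3 : a ^ 2 * (c ^ 2 + e + 1) + c ^ 2 * e * (c ^ 2 * e + e + c ^ 2) = 0)
    (h4 : b * (e + (a + 1)) = e * (a * (e * a + (a + e))))
    (ha : a ≠ 0) (ha1 : a + 1 ≠ 0) (he : e ≠ 0) (he1 : e + 1 ≠ 0) :
    a ^ 2 + (a + 1) = 0 ∨ a ^ 32 + a = 0 := by
  have vE : ev2 a e lE = e := by simp [lE, ev2, ev_zero, ev_one]
  have vA : ev2 a e lA = a := by simp [lA, ev2, ev_two]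
  have vA2 : ev2 a e lA2 = a ^ 2 := by simp [lA2, ev2, ev_four]
  have v1 : ev2 a e [1] = 1 := by simp [ev2, ev_one]
  have v5 : ev2 a e [5] = a ^ 2 + 1 := by simp [ev2, ev_five]
  have v20 : ev2 a e [20] = a ^ 2 * (a + 1) ^ 2 := by simp [ev2, ev_twenty]
  obtain ⟨Q, hQ⟩ : ∃ Q, Q = ev2 a e lQ := ⟨_, rfl⟩
  have vQ : Q = e + (a + 1) := by simp only [hQ, lQ, ev2_padd, vE, vA, v1]
  have vB : ev2 a e lB = b * Q := by
    simp only [lB, ev2_padd, ev2_pmul, vE, vA, vQ, h4]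
  obtain ⟨D, hD⟩ : ∃ D, D = ev2 a e lD := ⟨_, rfl⟩
  have vD : D = Q * (b * Q + (a ^ 2 + 1) * Q) := by
    simp only [hD, lD, ev2_padd, ev2_pmul, vB, v5, ← hQ]
  have vN : ev2 a e lN = c * D := by
    simp only [lN, ev2_padd, ev2_pmul, vB, v5, vA2, ← hQ]
    rw [vD]
    linear_combination (-Q ^ 2) * h1
  have vF2 : ev2 a e lF2 = 0 := by
    simp only [lF2, lB2, lQ2, ev2_padd, ev2_pmul, vB, vN, vE, ← hQ, ← hD]
    linear_combination (Q ^ 4 * D ^ 2) * h2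
  have vF3 : ev2 a e lF3 = 0 := by
    simp only [lF3, lN2, lD2, ev2_padd, ev2_pmul, vN, vE, vA2, ← hD]
    linear_combination (D ^ 4) * h3
  have k2 : ev2 a e lE2 = 0 := by
    rw [ev2_eq a e _ _ chk2] at vF2
    simpa [ev2_pmul, ev2_padd, vE, v1, he, he1] using vF2
  have k3 : ev2 a e lE3 = 0 := by
    rw [ev2_eq a e _ _ chk3] at vF3
    simpa [ev2_pmul, v20, ha, ha1] using vF3
  have kR := ev2_eq a e _ _ chkR
  rw [ev2_padd, ev2_pmul, ev2_pmul, k2, k3] at kR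
  simp only [ev2, ev_cl, ev_pw, ev_xor, ev_two, ev_three, ev_seven] at kR
  have kR' : a ^ 24 * (a + 1) ^ 24 * ((a ^ 2 + (a + 1)) ^ 29 * (a ^ 32 + a)) = 0 := by
    linear_combination -kR
  simpa [ha, ha1] using kR'

theorem last (a : K) (ha : a ≠ 0) (ha1 : a + 1 ≠ 0) (h : a ^ 32 = a)
    (h4 : a ^ 16 * (a ^ 4 + (a + 1)) = a ^ 4 * (a * (a ^ 4 * a + (a + a ^ 4)))) : False := by
  have h2 : (2 : K) = 0 := CharTwo.two_eq_zero
  have h31 : a ^ 31 + 1 = 0 := by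
    apply mul_left_cancel₀ ha
    linear_combination h + a * h2
  have h5 : a ^ 14 + (a ^ 11 + (a ^ 10 + (a ^ 4 + (a ^ 3 + 1)))) = 0 := by
    apply mul_left_cancel₀ (pow_ne_zero 6 ha)
    linear_combination h4 + (a ^ 6 + a ^ 9 + a ^ 10) * h2
  have k := ev2_eq a 0 _ _ chkF
  simp only [ev2, ev_cl, ev_pw, ev_xor, ev_two, ev_three, ev_one, h31, h5] at k
  exact ha1 (by linear_combination -k)

theorem main (m n : ℕ) (hm : 0 < m) (hn : n + 1 = 4 * m)
    (hK : ∀ y : K, y ^ 2 ^ n = y) (x : K) (hx0 : x ≠ 0) (hx1 : x ≠ 1) (d : ℕ)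
    (hd : 2 * d + 2 ^ m + 2 = 2 ^ (2 * m)) (h : (x + 1) ^ d + x ^ d + 1 = 0) : False := by
  have two : (2 : K) = 0 := CharTwo.two_eq_zero
  have hx1' : x + 1 ≠ 0 := fun h' => hx1 (CharTwo.add_eq_zero.mp h')
  obtain ⟨s, hs⟩ : ∃ s : K →+* K, ∀ y, s y = y ^ 2 ^ m :=
    ⟨iterateFrobenius K 2 m, fun y => iterateFrobenius_def 2 m y⟩
  have s4 : ∀ y, s (s (s (s y))) = y ^ 2 := by
    intro y
    simp only [hs, ← pow_mul, ← pow_add]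
    rw [show m + m + m + m = n + 1 by omega, pow_succ, pow_mul, hK]
  have sne : ∀ y, y ≠ 0 → s y ≠ 0 := fun y hy => by simpa using hy
  have sne1 : ∀ y, y + 1 ≠ 0 → s y + 1 ≠ 0 := fun y hy => by
    have := sne _ hy
    simpa using this
  have key : ∀ y : K, y ^ d * y ^ d * (s y * y ^ 2) = s (s y) := by
    intro y
    rw [hs (s y), hs y, ← pow_mul, ← pow_add, ← pow_add, ← pow_add, ← pow_add]
    congr 1
    rw [← two_mul m, ← hd]; ring
  have keyx := key x
  have keyx1 := key (x + 1)
  simp only [map_add, map_one] at keyx1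
  obtain ⟨b, hb⟩ : ∃ b, b = s x := ⟨_, rfl⟩
  obtain ⟨c, hc⟩ : ∃ c, c = s b := ⟨_, rfl⟩
  obtain ⟨e, he⟩ : ∃ e, e = s c := ⟨_, rfl⟩
  have ha : s e = x ^ 2 := by rw [he, hc, hb, s4]
  rw [← hb, ← hc] at keyx keyx1
  have e1 : c * (b + (x ^ 2 + 1)) + x ^ 2 * (b * ((x ^ 2 + 1) * b + x ^ 2)) = 0 := by
    have hg : (x + 1) ^ d = x ^ d + 1 := by
      linear_combination h - (x ^ d + 1) * two
    rw [hg] at keyx1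
    generalize x ^ d = g at *
    grind
  have e2 := congrArg s e1
  simp only [map_add, map_one, map_mul, map_pow, map_zero, ← hb, ← hc, ← he] at e2
  have e3 := congrArg s e2
  simp only [map_add, map_one, map_mul, map_pow, map_zero, ← hb, ← hc, ← he, ha] at e3
  have e4 := congrArg s e3
  simp only [map_add, map_one, map_mul, map_pow, map_zero, ← hb, ← hc, ← he, ha] at e4
  have h4 : b * (e + (x + 1)) = e * (x * (e * x + (x + e))) := by
    apply CharTwo.add_eq_zero.mp
    have : (b * (e + (x + 1)) + e * (x * (e * x + (x + e)))) ^ 2 = 0 := by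
      simp only [CharTwo.add_sq, mul_pow, one_pow]
      linear_combination e4
    simpa using this
  have hper : Function.IsPeriodicPt (fun y : K => y ^ 2) n x := by
    have : ∀ k, (fun y : K => y ^ 2)^[k] x = x ^ 2 ^ k := by
      intro k
      rw [pow_iterate]
    unfold Function.IsPeriodicPt Function.IsFixedPt
    rw [this, hK]
  have nf : ¬ Function.IsPeriodicPt (fun y : K => y ^ 2) 1 x := by
    intro h'
    have h'' : x ^ 2 = x := h'
    apply hx1
    apply mul_left_cancel₀ hx0
    linear_combination h''
  have be : e ≠ 0 := by rw [he, hc, hb]; exact sne _ (sne _ (sne _ hx0))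
  have be1 : e + 1 ≠ 0 := by rw [he, hc, hb]; exact sne1 _ (sne1 _ (sne1 _ hx1'))
  rcases elim x b c e (CharTwo.add_eq_zero.mp e1) (by linear_combination e2)
    (by linear_combination e3) h4 hx0 hx1' be be1 with h | h
  · have : Function.IsPeriodicPt (fun y : K => y ^ 2) 2 x := by
      change (x ^ 2) ^ 2 = x
      linear_combination (x ^ 2 + x) * h - (x ^ 3 + x ^ 2 + x) * two
    have g := this.gcd hper
    have : Nat.gcd 2 n = 1 := by
      rw [Nat.Coprime.gcd_eq_one]
      rw [Nat.coprime_two_left]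
      exact ⟨2 * m - 1, by omega⟩
    rw [this] at g
    exact nf g
  · have h32 : x ^ 32 = x := CharTwo.add_eq_zero.mp h
    have p5 : Function.IsPeriodicPt (fun y : K => y ^ 2) 5 x := by
      change ((((x ^ 2) ^ 2) ^ 2) ^ 2) ^ 2 = x
      linear_combination h32
    by_cases hn5 : 5 ∣ n
    · obtain ⟨j, hj⟩ : ∃ j, m = 5 * j + 4 := ⟨m / 5, by omega⟩
      have pj : ∀ y : K, y ^ 32 = y → y ^ 2 ^ (5 * j) = y := by
        intro y hy
        rw [pow_mul]
        clear hj
        induction j with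
        | zero => simp
        | succ j ih => rw [pow_succ, pow_mul, ih]; exact hy
      have sj : ∀ y : K, y ^ 32 = y → s y = y ^ 16 := by
        intro y hy
        rw [hs, hj, pow_add, pow_mul, pj y hy]; norm_num
      have b16 : b = x ^ 16 := by rw [hb, sj x h32]
      have c8 : c = x ^ 8 := by
        rw [hc, b16, map_pow, sj x h32]
        linear_combination (x ^ 224 + x ^ 193 + x ^ 162 + x ^ 131 + x ^ 100 + x ^ 69 + x ^ 38 + x ^ 7) * h32
      have e4' : e = x ^ 4 := by
        rw [he, c8, map_pow, sj x h32]
        linear_combination (x ^ 96 + x ^ 65 + x ^ 34 + x ^ 3) * h32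
      rw [b16, e4'] at h4
      exact last x hx0 hx1' h32 h4
    · have g := p5.gcd hper
      have : Nat.gcd 5 n = 1 := (Nat.Prime.coprime_iff_not_dvd (by norm_num)).mpr hn5
      rw [this] at g
      exact nf g

end

end ZApn

theorem zero_apn_9 (m : ℕ) (hm : 0 < m) 
    (x : GaloisField 2 (4*m-1)) (hx0 : x ≠ 0) (hx1 : x ≠ 1) :
    (x + 1) ^ (2^(2*m-1)-2^(m-1)-1) + x ^ (2^(2*m-1)-2^(m-1)-1) + 1 ≠ 0 := by
  intro h
  haveI : Fintype (GaloisField 2 (4*m-1)) := Fintype.ofFinite _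
  have hcard : Fintype.card (GaloisField 2 (4*m-1)) = 2 ^ (4*m-1) := by
    rw [← Nat.card_eq_fintype_card, GaloisField.card 2 (4*m-1) (by omega)]
  refine ZApn.main m (4*m-1) hm (by omega) (fun y => ?_) x hx0 hx1 _ ?_ h
  · rw [← hcard, FiniteField.pow_card]
  · obtain ⟨k, rfl⟩ : ∃ k, m = k + 1 := ⟨m - 1, by omega⟩
    have h1 : 2 * (k + 1) - 1 = k + k + 1 := by omega
    have h2 : 2 * (k + 1) = k + k + 1 + 1 := by omega
    rw [h1, h2, Nat.add_sub_cancel, pow_succ 2 (k + k + 1), pow_succ 2 (k + k), pow_succ 2 k, pow_add]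
    have h3 : 1 ≤ 2 ^ k := Nat.one_le_two_pow
    have h4 : 2 ^ k ≤ 2 ^ k * 2 ^ k := Nat.le_mul_self _
    omega
end
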